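/- Let k be a field, V a finite-dimensional k-vector space, and G ≤ GL(V) a finite group. If the action of G on V is coregular, then the action has the direct summand property. -/

import Mathlib

open MvPolynomial Matrix

set_option synthInstance.maxHeartbeats 1000000
set_option maxHeartbeats 1000000

variable {k : Type} [Field k] {ι : Type} [Fintype ι] [DecidableEq ι]

/-- Substitution of the variables by the linear forms determined by the matrix `g`. -/
noncomputable def polySub (g : Matrix ι ι k) :
    MvPolynomial ι k →ₐ[k] MvPolynomial ι k :=
  aeval fun i => ∑ j, C (g i j) * X j

/-- The (left) action of an invertible matrix `g` on polynomial functions,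
`(g • f)(v) = f (g⁻¹ *ᵥ v)`. -/
noncomputable def polyAct (g : Matrix ι ι k) :
    MvPolynomial ι k →ₐ[k] MvPolynomial ι k :=
  polySub g⁻¹

/-- The ring of invariants of a set of (invertible) matrices. -/
noncomputable def invariantRing (S : Set (Matrix ι ι k)) :
    Subalgebra k (MvPolynomial ι k) :=
  ⨅ g ∈ S, AlgHom.equalizer (polyAct g) (AlgHom.id k _)

/-- The direct summand property: there is a surjective `k[V]^G`-linear map
`k[V] → k[V]^G` respecting the gradings. -/
noncomputable def DirectSummand (S : Set (Matrix ι ι k)) : Prop :=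
  ∃ π : MvPolynomial ι k →ₗ[invariantRing S] invariantRing S,
    Function.Surjective π ∧
    ∀ (d : ℕ) (f : MvPolynomial ι k),
      f.IsHomogeneous d → ((π f : MvPolynomial ι k)).IsHomogeneous d

/-- Coregularity: the invariant ring is generated by `dim V` algebraically
independent homogeneous invariants. -/
noncomputable def Coregular (S : Set (Matrix ι ι k)) : Prop :=
  ∃ f : ι → MvPolynomial ι k,
    (∀ i, ∃ d, (f i).IsHomogeneous d) ∧
    AlgebraicIndependent k f ∧
    Algebra.adjoin k (Set.range f) = invariantRing S

/-- A pseudo-reflection: fixed-point space of codimension one. -/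
def IsPseudoReflection (g : Matrix ι ι k) : Prop :=
  Module.finrank k (LinearMap.ker (g.mulVecLin - LinearMap.id)) + 1 = Fintype.card ι

/-- The set of matrices underlying a subgroup of `GL`. -/
def matSet {n : ℕ} (G : Subgroup (GL (Fin n) k)) : Set (Matrix (Fin n) (Fin n) k) :=
  (fun g : GL (Fin n) k => (g : Matrix (Fin n) (Fin n) k)) '' (G : Set (GL (Fin n) k))

/-- The point stabilizer of a subspace `U`. -/
def pointStabilizer {n : ℕ} (G : Subgroup (GL (Fin n) k)) (U : Submodule k (Fin n → k)) :
    Subgroup (GL (Fin n) k) where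
  carrier := {g | g ∈ G ∧ ∀ u ∈ U, (g : Matrix (Fin n) (Fin n) k) *ᵥ u = u}
  one_mem' := ⟨G.one_mem, fun u _ => by simp⟩
  mul_mem' := fun {a b} ha hb => ⟨G.mul_mem ha.1 hb.1, fun u hu => by
    have h1 := ha.2 u hu
    have h2 := hb.2 u hu
    rw [Units.val_mul, ← Matrix.mulVec_mulVec, h2, h1]⟩
  inv_mem' := fun {a} ha => ⟨G.inv_mem ha.1, fun u hu => by
    conv_lhs => rw [← ha.2 u hu]
    rw [Matrix.mulVec_mulVec, Units.inv_mul, Matrix.one_mulVec]⟩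

section FrobeniusSplitting

/-- A homomorphism of fields admits an additive retraction that is linear over the source. -/
theorem RingHom.exists_addMonoidHom_retraction {K L : Type*} [Field K] [Field L] (F : K →+* L) :
    ∃ l : L →+ K, (∀ a b, l (F a * b) = a * l b) ∧ l 1 = 1 := by
  let := F.toAlgebra
  obtain ⟨g, hg⟩ := (Algebra.linearMap K L).exists_leftInverse_of_injective
    (LinearMap.ker_eq_bot.2 (algebraMap K L).injective)
  refine ⟨g.toAddMonoidHom, fun a b => ?_, ?_⟩
  · have h : g (a • b) = a • g b := map_smul g a b
    rwa [Algebra.smul_def, smul_eq_mul] at h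
  · have h := LinearMap.congr_fun hg 1
    simpa using h

namespace MvPolynomial

variable {σ K : Type*} [Field K]

/-- The additive map extracting from a polynomial the coefficients at the exponents `q • b + a`
and applying `l` to them. -/
theorem exists_coeff_smul_add (q : ℕ) (hq : q ≠ 0) (a : σ →₀ ℕ) (l : K →+ K) :
    ∃ T : MvPolynomial σ K →+ MvPolynomial σ K,
      ∀ s b, (T s).coeff b = l (s.coeff (q • b + a)) := by
  have hinj : Function.Injective fun b : σ →₀ ℕ => q • b + a := fun b c h => by
    ext i
    have h := DFunLike.congr_fun h i
    simpa [hq] using h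
  exact ⟨(AddMonoidAlgebra.coeffAddEquiv.symm.toAddMonoidHom.comp
    ((Finsupp.mapRange.addMonoidHom l).comp (Finsupp.comapDomain.addMonoidHom hinj))).comp
    AddMonoidAlgebra.coeffAddEquiv.toAddMonoidHom, fun s b => rfl⟩

/-- Polynomial rings over a field of characteristic `p` are strongly F-regular: every nonzero
element becomes a splitting of some iterate of the Frobenius. -/
theorem exists_frobenius_splitting (p : ℕ) [hp : Fact p.Prime] [CharP K p]
    {c : MvPolynomial σ K} (hc : c ≠ 0) :
    ∃ (e : ℕ) (T : MvPolynomial σ K →+ MvPolynomial σ K) (u : MvPolynomial σ K),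
      (∀ r s, T (r ^ p ^ e * s) = r * T s) ∧ T (u * c) = 1 := by
  obtain ⟨a, ha⟩ := ne_zero_iff.1 hc
  obtain ⟨e, he⟩ : ∃ e, c.totalDegree < p ^ e :=
    ⟨_, Nat.lt_pow_self hp.out.one_lt⟩
  have hq : p ^ e ≠ 0 := pow_ne_zero _ hp.out.ne_zero
  have hdeg : ∀ m i, c.coeff m ≠ 0 → m i < p ^ e := fun m i hm =>
    ((Finsupp.le_degree i m).trans (le_totalDegree (mem_support_iff.2 hm))).trans_lt he
  obtain ⟨l, hl, hl1⟩ := (iterateFrobenius K p e).exists_addMonoidHom_retraction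
  simp only [iterateFrobenius_def] at hl
  obtain ⟨T, hT⟩ := exists_coeff_smul_add (p ^ e) hq a l
  refine ⟨e, T, C (c.coeff a)⁻¹, fun r => ?_, ?_⟩
  · induction r using MvPolynomial.induction_on with
    | C x =>
      intro s
      ext b
      rw [← C_pow, hT, coeff_C_mul, coeff_C_mul, hl, hT]
    | add r₁ r₂ h₁ h₂ =>
      intro s
      rw [add_pow_char_pow, add_mul, map_add, h₁, h₂, add_mul]
    | mul_X r i h =>
      intro s
      rw [mul_pow, mul_assoc, h, mul_assoc]
      congr 1
      ext b
      classical
      rw [hT, X_pow_eq_monomial, X, coeff_monomial_mul', coeff_monomial_mul', one_mul, one_mul]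
      have hai := hdeg a i ha
      by_cases hb : b i = 0
      · rw [if_neg, if_neg, map_zero]
        · simp [hb]
        · simp [hb, hai]
      · rw [if_pos, if_pos, hT]
        · congr 2
          ext j
          by_cases hj : i = j
          · subst hj
            obtain ⟨t, ht⟩ := Nat.exists_eq_succ_of_ne_zero hb
            simp [ht, mul_add]
            omega
          · simp [hj]
        · simpa [Nat.one_le_iff_ne_zero] using hb
        · simpa using le_add_right (Nat.le_mul_of_pos_right (p ^ e) (Nat.pos_of_ne_zero hb))
  · ext b
    classical
    rw [hT, coeff_C_mul, coeff_one]
    split_ifs with hb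
    · simp [← hb, ha, hl1]
    · obtain ⟨i, hi⟩ : ∃ i, b i ≠ 0 := by
        by_contra! h
        exact hb (Finsupp.ext fun i => (h i).symm)
      have h0 : c.coeff (p ^ e • b + a) = 0 := by
        by_contra h
        have h1 := hdeg _ i h
        simp only [Finsupp.coe_add, Finsupp.coe_smul, Pi.add_apply, Pi.smul_apply,
          smul_eq_mul] at h1
        have h2 := Nat.le_mul_of_pos_right (p ^ e) (Nat.pos_of_ne_zero hi)
        omega
      rw [h0, mul_zero, map_zero]

/-- If `A` is isomorphic to a polynomial ring over a field of characteristic `p`, and `S` is an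
`A`-algebra with a nonzero `A`-linear map to `A`, then `A → S` splits. -/
theorem exists_linearMap_map_one_eq_one_of_ringEquiv (p : ℕ) [hp : Fact p.Prime] [CharP K p]
    {A S : Type*} [CommRing A] [CommRing S] [Algebra A S] [CharP S p]
    (ε : MvPolynomial σ K ≃+* A) {φ : S →ₗ[A] A} (hφ : φ ≠ 0) :
    ∃ π : S →ₗ[A] A, π 1 = 1 := by
  obtain ⟨s₀, hs₀⟩ : ∃ s, φ s ≠ 0 := by
    by_contra! h
    exact hφ (LinearMap.ext h)
  obtain ⟨e, T, u, hT, hu⟩ := exists_frobenius_splitting p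
    (c := ε.symm (φ s₀)) (by simpa using hs₀)
  refine ⟨{ toFun := fun s => ε (T (ε.symm (φ (s ^ p ^ e * (ε u • s₀)))))
            map_add' := fun s t => ?_
            map_smul' := fun r s => ?_ }, ?_⟩
  · simp only [add_pow_char_pow, add_mul, map_add]
  · rw [smul_pow, smul_mul_assoc, map_smul, smul_eq_mul, map_mul, map_pow, hT, map_mul]
    simp
  · simp [hu]

end MvPolynomial

end FrobeniusSplitting

section Grading

namespace MvPolynomial

variable {σ K : Type*} [CommSemiring K]

theorem IsHomogeneous.homogeneousComponent_add_mul {r : MvPolynomial σ K} {i : ℕ}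
    (hr : r.IsHomogeneous i) (j : ℕ) (t : MvPolynomial σ K) :
    homogeneousComponent (i + j) (r * t) = r * homogeneousComponent j t := by
  classical
  conv_lhs => rw [← sum_homogeneousComponent t, Finset.mul_sum, map_sum]
  have h : ∀ l, homogeneousComponent (i + j) (r * homogeneousComponent l t) =
      if l = j then r * homogeneousComponent j t else 0 := fun l => by
    rw [homogeneousComponent_of_mem (hr.mul (homogeneousComponent_isHomogeneous l t))]
    by_cases hl : l = j
    · simp [hl]
    · rw [if_neg hl, if_neg (by omega)]
  simp only [h, Finset.sum_ite_eq', Finset.mem_range]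
  split_ifs with hj
  · rfl
  · rw [homogeneousComponent_eq_zero _ _ (by omega), mul_zero]

/-- An algebra endomorphism preserving homogeneity commutes with taking homogeneous components. -/
theorem homogeneousComponent_algHom_apply {g : MvPolynomial σ K →ₐ[K] MvPolynomial σ K}
    (hg : ∀ d f, f.IsHomogeneous d → (g f).IsHomogeneous d) (d : ℕ) (f : MvPolynomial σ K) :
    homogeneousComponent d (g f) = g (homogeneousComponent d f) := by
  classical
  conv_lhs => rw [← sum_homogeneousComponent f, map_sum, map_sum]
  have h : ∀ l, homogeneousComponent d (g (homogeneousComponent l f)) =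
      if l = d then g (homogeneousComponent d f) else 0 := fun l => by
    rw [homogeneousComponent_of_mem (hg _ _ (homogeneousComponent_isHomogeneous l f))]
    by_cases hl : l = d
    · simp [hl]
    · rw [if_neg hl, if_neg (by omega)]
  simp only [h, Finset.sum_ite_eq', Finset.mem_range]
  split_ifs with hj
  · rfl
  · rw [homogeneousComponent_eq_zero _ _ (by omega), map_zero]

/-- The degree-preserving part of a linear endomorphism of a polynomial ring. -/
theorem exists_degree_preserving_part (ψ : MvPolynomial σ K →ₗ[K] MvPolynomial σ K) :
    ∃ ψ' : MvPolynomial σ K →ₗ[K] MvPolynomial σ K,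
      ∀ d f, f.IsHomogeneous d → ψ' f = homogeneousComponent d (ψ f) := by
  refine ⟨(basisMonomials σ K).constr K fun m => homogeneousComponent m.degree (ψ (monomial m 1)),
    fun d f hf => ?_⟩
  have hmon : ∀ m, (basisMonomials σ K).constr K
      (fun m => homogeneousComponent m.degree (ψ (monomial m 1))) (monomial m 1) =
      homogeneousComponent m.degree (ψ (monomial m 1)) := fun m => by
    simpa using (basisMonomials σ K).constr_basis K
      (fun m => homogeneousComponent m.degree (ψ (monomial m 1))) m
  have hf' : f = ∑ m ∈ f.support, f.coeff m • monomial m (1 : K) := by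
    conv_lhs => rw [f.as_sum]
    simp [smul_monomial]
  conv_rhs => rw [hf']
  conv_lhs => rw [hf']
  simp only [map_sum, map_smul]
  refine Finset.sum_congr rfl fun m hm => ?_
  rw [hmon, hf.degree_eq_sum_deg_support hm]
  rfl

end MvPolynomial

/-- A retraction onto a graded subalgebra of a polynomial ring can be made degree-preserving. -/
theorem Subalgebra.exists_graded_retraction {σ K : Type*} [CommRing K]
    (A : Subalgebra K (MvPolynomial σ K))
    (hA : ∀ d, ∀ f ∈ A, homogeneousComponent d f ∈ A)
    (π : MvPolynomial σ K →ₗ[A] A) (hπ : π 1 = 1) :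
    ∃ π' : MvPolynomial σ K →ₗ[A] A, π' 1 = 1 ∧
      ∀ (d : ℕ) (f : MvPolynomial σ K),
        f.IsHomogeneous d → (π' f : MvPolynomial σ K).IsHomogeneous d := by
  obtain ⟨ψ, hψ⟩ := exists_degree_preserving_part
    (A.val.toLinearMap.comp (π.restrictScalars K))
  replace hψ : ∀ d f, f.IsHomogeneous d →
      ψ f = homogeneousComponent d (π f : MvPolynomial σ K) := hψ
  have hmem : ∀ f, ψ f ∈ A := fun f => by
    rw [← sum_homogeneousComponent f, map_sum]
    refine sum_mem fun d _ => ?_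
    rw [hψ d _ (homogeneousComponent_isHomogeneous d f)]
    exact hA d _ (π _).2
  have hmul : ∀ r ∈ A, ∀ f, ψ (r * f) = r * ψ f := fun r hr f => by
    have key : ∀ i j, ψ (homogeneousComponent i r * homogeneousComponent j f) =
        homogeneousComponent i r * ψ (homogeneousComponent j f) := fun i j => by
      have hi := homogeneousComponent_isHomogeneous i r
      have hj := homogeneousComponent_isHomogeneous j f
      rw [hψ _ _ (hi.mul hj), hψ _ _ hj,
        ← hi.homogeneousComponent_add_mul j (π (homogeneousComponent j f) : MvPolynomial σ K)]
      refine congrArg _ ?_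
      have h := congrArg Subtype.val
        (map_smul π (⟨homogeneousComponent i r, hA i r hr⟩ : A) (homogeneousComponent j f))
      exact h
    rw [← sum_homogeneousComponent r, ← sum_homogeneousComponent f]
    simp only [Finset.sum_mul_sum, map_sum, key]
  refine ⟨{ toFun := fun f => ⟨ψ f, hmem f⟩
            map_add' := fun f g => Subtype.ext (map_add ψ f g)
            map_smul' := fun r f => Subtype.ext (hmul r r.2 f) }, Subtype.ext ?_, fun d f hf => ?_⟩
  · change ψ 1 = 1
    rw [hψ 0 1 (isHomogeneous_one σ K), hπ]
    exact homogeneousComponent_eq_self (isHomogeneous_one σ K)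
  · change (ψ f).IsHomogeneous d
    rw [hψ d f hf]
    exact homogeneousComponent_isHomogeneous _ _

end Grading

section Action

theorem polySub_X {τ : Type} [Fintype τ] (g : Matrix τ τ k) (i : τ) :
    polySub g (X i) = ∑ j, C (g i j) * X j :=
  aeval_X _ _

theorem polySub_polySub {τ : Type} [Fintype τ] (g h : Matrix τ τ k)
    (f : MvPolynomial τ k) :
    polySub g (polySub h f) = polySub (h * g) f := by
  suffices (polySub g).comp (polySub h) = polySub (h * g) from DFunLike.congr_fun this f
  ext1 i
  simp only [AlgHom.comp_apply, polySub_X, map_sum, map_mul, algHom_C, algebraMap_eq,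
    Matrix.mul_apply, Finset.mul_sum, Finset.sum_mul]
  rw [Finset.sum_comm]
  simp only [mul_assoc]

theorem polyAct_polyAct (g h : Matrix ι ι k) (f : MvPolynomial ι k) :
    polyAct g (polyAct h f) = polyAct (g * h) f := by
  rw [polyAct, polyAct, polyAct, polySub_polySub, Matrix.mul_inv_rev]

theorem polySub_injective : Function.Injective (polySub : Matrix ι ι k → _) := fun g h hgh => by
  ext i j
  have h1 := congrArg (coeff (Finsupp.single j 1)) (DFunLike.congr_fun hgh (X i))
  simpa [polySub_X, coeff_sum, coeff_C_mul, coeff_X, Finsupp.single_left_inj] using h1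

theorem isHomogeneous_polySub {τ : Type} [Fintype τ] (g : Matrix τ τ k) (d : ℕ)
    (f : MvPolynomial τ k) (hf : f.IsHomogeneous d) : (polySub g f).IsHomogeneous d := by
  rw [← one_mul d]
  exact hf.aeval (fun i => ∑ j, C (g i j) * X j)
    (fun i => IsHomogeneous.sum _ _ _ fun j _ => isHomogeneous_C_mul_X (g i j) j)

theorem mem_invariantRing {S : Set (Matrix ι ι k)} {f : MvPolynomial ι k} :
    f ∈ invariantRing S ↔ ∀ g ∈ S, polyAct g f = f := by
  simp [invariantRing, Algebra.mem_iInf, AlgHom.mem_equalizer]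

theorem homogeneousComponent_mem_invariantRing (S : Set (Matrix ι ι k)) (d : ℕ)
    (f : MvPolynomial ι k) (hf : f ∈ invariantRing S) :
    homogeneousComponent d f ∈ invariantRing S := by
  rw [mem_invariantRing] at hf ⊢
  intro g hg
  rw [polyAct, ← homogeneousComponent_algHom_apply (isHomogeneous_polySub _), ← polyAct, hf g hg]

variable {n : ℕ}

theorem mem_invariantRing_matSet {G : Subgroup (GL (Fin n) k)} {f : MvPolynomial (Fin n) k} :
    f ∈ invariantRing (matSet G) ↔
      ∀ g : G, polyAct ((g : GL (Fin n) k) : Matrix (Fin n) (Fin n) k) f = f := by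
  simp [mem_invariantRing, matSet]

/-- The transfer map of a finite linear group. -/
noncomputable def invariantTransfer (G : Subgroup (GL (Fin n) k)) [Fintype G] :
    MvPolynomial (Fin n) k →ₗ[invariantRing (matSet G)] invariantRing (matSet G) where
  toFun f := ⟨∑ g : G, polyAct ((g : GL (Fin n) k) : Matrix (Fin n) (Fin n) k) f, by
    rw [mem_invariantRing_matSet]
    intro h
    simp only [map_sum, polyAct_polyAct]
    exact Fintype.sum_equiv (Equiv.mulLeft h) _ _ fun g => by simp⟩
  map_add' f₁ f₂ := Subtype.ext <| by simp [Finset.sum_add_distrib]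
  map_smul' r f := Subtype.ext <| by
    have hr := mem_invariantRing_matSet.1 r.2
    simp [Subalgebra.smul_def, hr, Finset.mul_sum]

theorem coe_invariantTransfer (G : Subgroup (GL (Fin n) k)) [Fintype G]
    (f : MvPolynomial (Fin n) k) :
    (invariantTransfer G f : MvPolynomial (Fin n) k) =
      ∑ g : G, polyAct ((g : GL (Fin n) k) : Matrix (Fin n) (Fin n) k) f := rfl

theorem invariantTransfer_ne_zero (G : Subgroup (GL (Fin n) k)) [Fintype G] :
    invariantTransfer G ≠ 0 := fun h0 => by
  have hinj : Function.Injective fun g : G =>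
      ((polyAct ((g : GL (Fin n) k) : Matrix (Fin n) (Fin n) k) :
        MvPolynomial (Fin n) k →ₐ[k] MvPolynomial (Fin n) k) :
        MvPolynomial (Fin n) k →* MvPolynomial (Fin n) k) := fun g h hgh => by
    have h1 : polyAct ((g : GL (Fin n) k) : Matrix (Fin n) (Fin n) k) =
        polyAct ((h : GL (Fin n) k) : Matrix (Fin n) (Fin n) k) :=
      AlgHom.ext fun f => DFunLike.congr_fun hgh f
    have h2 := polySub_injective h1
    rw [← Matrix.coe_units_inv, ← Matrix.coe_units_inv] at h2
    exact Subtype.ext (inv_injective (Units.ext h2))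
  have hli := (linearIndependent_monoidHom (MvPolynomial (Fin n) k)
    (MvPolynomial (Fin n) k)).comp _ hinj
  have h1 := Fintype.linearIndependent_iff.1 hli (fun _ => 1) (by
    ext1 f
    have h2 := congrArg Subtype.val (LinearMap.congr_fun h0 f)
    simpa [coe_invariantTransfer] using h2) 1
  exact one_ne_zero h1

theorem exists_invariantRing_retraction_of_charZero (G : Subgroup (GL (Fin n) k)) [Fintype G]
    [CharZero k] :
    ∃ π : MvPolynomial (Fin n) k →ₗ[invariantRing (matSet G)] invariantRing (matSet G),
      π 1 = 1 := by
  refine ⟨algebraMap k (invariantRing (matSet G)) (Fintype.card G : k)⁻¹ • invariantTransfer G,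
    Subtype.ext ?_⟩
  have hcard : (Fintype.card G : k) ≠ 0 := Nat.cast_ne_zero.2 Fintype.card_ne_zero
  have h : C (Fintype.card G : k)⁻¹ * C (Fintype.card G : k) = (1 : MvPolynomial (Fin n) k) := by
    rw [← C_mul, inv_mul_cancel₀ hcard, C_1]
  simpa [coe_invariantTransfer, smul_eq_C_mul] using h

end Action

/-- If the action of a finite group `G ≤ GL(V)` on `V` is coregular, then it has
the direct summand property. -/
theorem directSummand_of_coregular {k : Type} [Field k] {n : ℕ}
    (G : Subgroup (GL (Fin n) k)) [Finite G]
    (hG : Coregular (matSet G)) :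
    DirectSummand (matSet G) := by
  obtain ⟨f, -, hf, hadj⟩ := hG
  have := Fintype.ofFinite G
  obtain ⟨π, hπ⟩ : ∃ π : MvPolynomial (Fin n) k →ₗ[invariantRing (matSet G)]
      invariantRing (matSet G), π 1 = 1 := by
    obtain ⟨p, hp⟩ := CharP.exists k
    obtain hprime | rfl := CharP.char_is_prime_or_zero k p
    · have := Fact.mk hprime
      exact exists_linearMap_map_one_eq_one_of_ringEquiv p
        (hf.aevalEquiv.trans (Subalgebra.equivOfEq _ _ hadj)).toRingEquiv
        (invariantTransfer_ne_zero G)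
    · have := CharP.charP_to_charZero k
      exact exists_invariantRing_retraction_of_charZero G
  obtain ⟨π', hπ', hdeg⟩ := (invariantRing (matSet G)).exists_graded_retraction
    (homogeneousComponent_mem_invariantRing _) π hπ
  refine ⟨π', fun r => ⟨(r : MvPolynomial (Fin n) k), ?_⟩, hdeg⟩
  have h := map_smul π' r 1
  rwa [hπ', Subalgebra.smul_def, smul_eq_mul, smul_eq_mul, mul_one, mul_one] at h
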